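/- Minima in the unlabeled cut distance: let d be an invariant and smooth distance on the space 𝒲₁ of probability-graphons. Then for all U, W ∈ 𝒲₁: inf_{φ∈S_{[0,1]}} d(U, W^φ) = inf_{φ∈S̄_{[0,1]}} d(U, W^φ) = inf_{ψ∈S_{[0,1]}} d(U^ψ, W) = inf_{ψ∈S̄_{[0,1]}} d(U^ψ, W) = inf_{φ,ψ∈S_{[0,1]}} d(U^ψ, W^φ) = min_{φ,ψ∈S̄_{[0,1]}} d(U^ψ, W^φ); in particular, the infimum over pairs of (not necessarily bijective) measure-preserving maps φ, ψ ∈ S̄_{[0,1]} of d(U^ψ, W^φ) is attained. -/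

import Mathlib

open MeasureTheory Filter Topology
open scoped ENNReal NNReal

noncomputable section

namespace PG

/-- The unit square `[0,1]²`, with its product Lebesgue measure. -/
abbrev Sq : Type := unitInterval × unitInterval

variable {Z : Type*} [MeasurableSpace Z] [TopologicalSpace Z]

/-! ### Measure-valued kernels and probability-graphons -/

/-- `W(A;·) = ∫_A W(x,y;·) dx dy` for a measure-valued kernel. -/
def kernelInt (W : Sq → Measure Z) (A : Set Sq) : Measure Z :=
  ((volume : Measure Sq).restrict A).bind W

/-- The measure `M_W = W([0,1]²;·)` associated with a (positive) measure-valued kernel. -/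
def MW (W : Sq → Measure Z) : Measure Z := (volume : Measure Sq).bind W

/-- A probability-graphon: a measurable map from `[0,1]²` to probability measures on `Z`. -/
def IsProbGraphon (W : Sq → Measure Z) : Prop :=
  (∀ A : Set Z, MeasurableSet A → Measurable fun p => W p A) ∧
    ∀ p, IsProbabilityMeasure (W p)

/-- Essential supremum of the total mass of a positive measure-valued kernel. -/
def TVboundPos (W : Sq → Measure Z) : ℝ≥0∞ :=
  essSup (fun p => W p Set.univ) (volume : Measure Sq)

/-- A (positive) measure-valued kernel: measurable and essentially bounded. -/
def IsPosKernel (W : Sq → Measure Z) : Prop :=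
  (∀ A : Set Z, MeasurableSet A → Measurable fun p => W p A) ∧ TVboundPos W < ⊤

/-- Relabeling `W^φ` of a kernel by a map `φ : [0,1] → [0,1]`. -/
def relabel (W : Sq → Measure Z) (φ : unitInterval → unitInterval) : Sq → Measure Z :=
  fun p => W (φ p.1, φ p.2)

/-- `φ` is a Lebesgue-measure-preserving map of `[0,1]`. -/
def IsMP (φ : unitInterval → unitInterval) : Prop :=
  MeasurePreserving φ (volume : Measure unitInterval) (volume : Measure unitInterval)

/-- Weak convergence of a sequence of (finite) measures on `Z`. -/
def WeakTendsto (μ : ℕ → Measure Z) (ν : Measure Z) : Prop :=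
  ∀ f : BoundedContinuousFunction Z ℝ,
    Tendsto (fun n => ∫ x, f x ∂(μ n)) atTop (𝓝 (∫ x, f x ∂ν))

/-- The cut distance `d_{□,m}` associated with a distance `d_m` on measures. -/
def cutDist (dm : Measure Z → Measure Z → ℝ) (U W : Sq → Measure Z) : ℝ :=
  ⨆ ST : {p : Set unitInterval × Set unitInterval // MeasurableSet p.1 ∧ MeasurableSet p.2},
    dm (kernelInt U (ST.val.1 ×ˢ ST.val.2)) (kernelInt W (ST.val.1 ×ˢ ST.val.2))

/-- The unlabeled cut distance `δ_□` associated with a distance `d` on kernels: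
`δ_□(U,W) = inf_{φ ∈ S_{[0,1]}} d(U, W^φ)`. -/
def deltaCut (d : (Sq → Measure Z) → (Sq → Measure Z) → ℝ) (U W : Sq → Measure Z) : ℝ :=
  ⨅ φ : {φ : unitInterval → unitInterval // IsMP φ ∧ Function.Bijective φ},
    d U (relabel W φ.val)

/-- Weak isomorphism of kernels: `U^φ = W^ψ` a.e. for some measure-preserving `φ, ψ`. -/
def WeakIso (U W : Sq → Measure Z) : Prop :=
  ∃ φ ψ : unitInterval → unitInterval, IsMP φ ∧ IsMP ψ ∧
    relabel U φ =ᵐ[(volume : Measure Sq)] relabel W ψ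

/-- A family of kernels is tight if the family of measures `{M_W}` is tight. -/
def TightFamily (K : Set (Sq → Measure Z)) : Prop :=
  ∀ ε : ℝ≥0∞, 0 < ε → ∃ K₀ : Set Z, IsCompact K₀ ∧ ∀ W ∈ K, MW W K₀ᶜ ≤ ε

/-- Invariance of a distance on probability-graphons under bijective
measure-preserving relabelings. -/
def Invariant (d : (Sq → Measure Z) → (Sq → Measure Z) → ℝ) : Prop :=
  ∀ U W : Sq → Measure Z, IsProbGraphon U → IsProbGraphon W →
    ∀ φ : unitInterval → unitInterval, IsMP φ → Function.Bijective φ →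
      d (relabel U φ) (relabel W φ) = d U W

/-- Smoothness of a distance on probability-graphons: a.e. weak convergence implies
convergence in `d`. -/
def Smooth (d : (Sq → Measure Z) → (Sq → Measure Z) → ℝ) : Prop :=
  ∀ (Wn : ℕ → Sq → Measure Z) (W : Sq → Measure Z),
    (∀ n, IsProbGraphon (Wn n)) → IsProbGraphon W →
    (∀ᵐ p ∂(volume : Measure Sq), WeakTendsto (fun n => Wn n p) (W p)) →
    Tendsto (fun n => d (Wn n) W) atTop (𝓝 0)

/-- `d` is a distance on the space `𝒲₁` of probability-graphons (where kernels that
agree a.e. are identified). -/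
def IsGraphonDist (d : (Sq → Measure Z) → (Sq → Measure Z) → ℝ) : Prop :=
  (∀ U W, IsProbGraphon U → IsProbGraphon W → d U W = d W U) ∧
  (∀ U W, IsProbGraphon U → IsProbGraphon W → 0 ≤ d U W) ∧
  (∀ U V W, IsProbGraphon U → IsProbGraphon V → IsProbGraphon W → d U W ≤ d U V + d V W) ∧
  (∀ U W, IsProbGraphon U → IsProbGraphon W →
    (d U W = 0 ↔ U =ᵐ[(volume : Measure Sq)] W))

/-- Distance axioms for `d` on a subset `M`. -/
def IsDistOnSet {α : Type*} (M : Set α) (d : α → α → ℝ) : Prop :=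
  (∀ x ∈ M, ∀ y ∈ M, d x y = d y x) ∧
  (∀ x ∈ M, ∀ y ∈ M, 0 ≤ d x y) ∧
  (∀ x ∈ M, ∀ y ∈ M, ∀ z ∈ M, d x z ≤ d x y + d y z) ∧
  (∀ x ∈ M, ∀ y ∈ M, (d x y = 0 ↔ x = y))

/-- The set `ℳ≤1(Z)` of measures of total mass at most one. -/
def SubProb (Z : Type*) [MeasurableSpace Z] : Set (Measure Z) := {μ | μ Set.univ ≤ 1}

/-- `d_m` is a distance on `ℳ≤1(Z)`. -/
def IsDistOnSubProb (dm : Measure Z → Measure Z → ℝ) : Prop :=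
  IsDistOnSet (SubProb Z) dm

/-- `d_m` induces the weak topology on `ℳ≤1(Z)` (sequential formulation; the weak
topology on `ℳ≤1(Z)` is metrizable, so it is characterized by its convergent
sequences). -/
def InducesWeakTopologySub (dm : Measure Z → Measure Z → ℝ) : Prop :=
  ∀ (μn : ℕ → Measure Z) (μ : Measure Z), (∀ n, μn n ∈ SubProb Z) → μ ∈ SubProb Z →
    (Tendsto (fun n => dm (μn n) μ) atTop (𝓝 0) ↔ WeakTendsto μn μ)

/-- Quasi-convexity of a distance on the convex set `ℳ₊(Z)` of finite measures. -/
def QuasiConvexPos (dm : Measure Z → Measure Z → ℝ) : Prop :=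
  ∀ μ₁ μ₂ ν₁ ν₂ : Measure Z, IsFiniteMeasure μ₁ → IsFiniteMeasure μ₂ →
    IsFiniteMeasure ν₁ → IsFiniteMeasure ν₂ → ∀ a : ℝ≥0∞, a ≤ 1 →
    dm (a • μ₁ + (1 - a) • μ₂) (a • ν₁ + (1 - a) • ν₂) ≤ max (dm μ₁ ν₁) (dm μ₂ ν₂)

/-! ### Finite partitions of `[0,1]` and the stepping operator -/

/-- A finite measurable partition of `[0,1]` (possibly with empty classes). -/
structure FinPartition : Type where
  n : ℕ
  part : Fin n → Set unitInterval
  measurableSet : ∀ i, MeasurableSet (part i)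
  disjoint : ∀ i j, i ≠ j → Disjoint (part i) (part j)
  covers : (⋃ i, part i) = Set.univ

/-- `P` refines `Q`: every class of `P` is included in a class of `Q`. -/
def FinPartition.Refines (P Q : FinPartition) : Prop :=
  ∀ i, ∃ j, P.part i ⊆ Q.part j

/-- The stepping `W_𝒫` of a (positive) measure-valued kernel `W` with respect to a
finite partition `𝒫`: on `S_i × S_j` it equals `W(S_i×S_j;·)/(λ(S_i)λ(S_j))`
(and the zero measure on classes of zero measure). -/
def stepping (W : Sq → Measure Z) (P : FinPartition) : Sq → Measure Z :=
  fun p => ∑ i : Fin P.n, ∑ j : Fin P.n,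
    Set.indicator (P.part i ×ˢ P.part j)
      (fun _ => ((volume (P.part i)) * (volume (P.part j)))⁻¹ •
        kernelInt W (P.part i ×ˢ P.part j)) p

/-- Weak regularity of a distance on probability-graphons. -/
def WeaklyRegular (d : (Sq → Measure Z) → (Sq → Measure Z) → ℝ) : Prop :=
  ∀ K : Set (Sq → Measure Z), (∀ W ∈ K, IsProbGraphon W) → TightFamily K →
    ∀ ε : ℝ, 0 < ε → ∃ m : ℕ, 0 < m ∧
      ∀ W ∈ K, ∀ Q : FinPartition, ∃ P : FinPartition,
        P.Refines Q ∧ P.n ≤ m * Q.n ∧ d W (stepping W P) < ε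

/-- Regularity of a distance on probability-graphons with respect to the stepping
operator. -/
def SteppingRegular (d : (Sq → Measure Z) → (Sq → Measure Z) → ℝ) : Prop :=
  ∃ C₀ : ℝ, 0 < C₀ ∧ ∀ W U : Sq → Measure Z, IsProbGraphon W → IsProbGraphon U →
    ∀ P : FinPartition, d W (stepping W P) ≤ C₀ * d W (stepping U P)

/-! ### Signed measure-valued kernels -/

/-- The signed measure associated with a finite measure (and junk value `0` on
non-finite measures). -/
def toSigned (μ : Measure Z) : SignedMeasure Z :=
  letI := Classical.dec (IsFiniteMeasure μ)
  if h : IsFiniteMeasure μ then @Measure.toSignedMeasure Z _ μ h else 0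

/-- `W(A;·)` for a signed measure-valued kernel. -/
def skernelInt (W : Sq → SignedMeasure Z) (A : Set Sq) : SignedMeasure Z :=
  toSigned (((volume : Measure Sq).restrict A).bind
      fun p => (W p).toJordanDecomposition.posPart)
    - toSigned (((volume : Measure Sq).restrict A).bind
      fun p => (W p).toJordanDecomposition.negPart)

/-- Total mass `‖s‖_TV` of the total variation of a signed measure. -/
def TVnorm (s : SignedMeasure Z) : ℝ≥0∞ := s.totalVariation Set.univ

/-- `‖W‖∞`, the essential supremum of the total variation masses of a signed
measure-valued kernel. -/
def TVbound (W : Sq → SignedMeasure Z) : ℝ≥0∞ :=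
  essSup (fun p => TVnorm (W p)) (volume : Measure Sq)

/-- A signed measure-valued kernel: measurable in `(x,y)` and essentially bounded in
total variation. -/
def IsSignedKernel (W : Sq → SignedMeasure Z) : Prop :=
  (∀ A : Set Z, MeasurableSet A → Measurable fun p => W p A) ∧ TVbound W < ⊤

/-- The measure `M_W = ∫ |W|(x,y;·) dx dy` of a signed measure-valued kernel. -/
def MWs (W : Sq → SignedMeasure Z) : Measure Z :=
  (volume : Measure Sq).bind fun p => (W p).totalVariation

/-- Tightness for a family of signed measure-valued kernels. -/
def TightFamilyS (K : Set (Sq → SignedMeasure Z)) : Prop :=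
  ∀ ε : ℝ≥0∞, 0 < ε → ∃ K₀ : Set Z, IsCompact K₀ ∧ ∀ W ∈ K, MWs W K₀ᶜ ≤ ε

/-- Integral of a bounded continuous function against a signed measure. -/
def sint (f : BoundedContinuousFunction Z ℝ) (s : SignedMeasure Z) : ℝ :=
  ∫ x, f x ∂s.toJordanDecomposition.posPart - ∫ x, f x ∂s.toJordanDecomposition.negPart

/-- Weak convergence of signed measures. -/
def WeakTendstoS (s : ℕ → SignedMeasure Z) (t : SignedMeasure Z) : Prop :=
  ∀ f : BoundedContinuousFunction Z ℝ,
    Tendsto (fun n => sint f (s n)) atTop (𝓝 (sint f t))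

/-- Stepping of a signed measure-valued kernel with respect to a finite partition. -/
def steppingS (W : Sq → SignedMeasure Z) (P : FinPartition) : Sq → SignedMeasure Z :=
  fun p => ∑ i : Fin P.n, ∑ j : Fin P.n,
    Set.indicator (P.part i ×ˢ P.part j)
      (fun _ => (((volume (P.part i)).toReal * (volume (P.part j)).toReal)⁻¹ : ℝ) •
        skernelInt W (P.part i ×ˢ P.part j)) p

/-- Cut distance for signed measure-valued kernels associated with a distance `d_m`
on signed measures. -/
def cutDistS (dm : SignedMeasure Z → SignedMeasure Z → ℝ) (U W : Sq → SignedMeasure Z) : ℝ :=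
  ⨆ ST : {p : Set unitInterval × Set unitInterval // MeasurableSet p.1 ∧ MeasurableSet p.2},
    dm (skernelInt U (ST.val.1 ×ˢ ST.val.2)) (skernelInt W (ST.val.1 ×ˢ ST.val.2))

/-- Quasi-convexity of a distance on a convex subset `M` of signed measures. -/
def QuasiConvexOn (M : Set (SignedMeasure Z)) (dm : SignedMeasure Z → SignedMeasure Z → ℝ) :
    Prop :=
  ∀ x₁ ∈ M, ∀ x₂ ∈ M, ∀ y₁ ∈ M, ∀ y₂ ∈ M, ∀ a : ℝ, 0 ≤ a → a ≤ 1 →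
    dm (a • x₁ + (1 - a) • x₂) (a • y₁ + (1 - a) • y₂) ≤ max (dm x₁ y₁) (dm x₂ y₂)

/-! ### Convergence determining sequences and the associated norms -/

/-- `F` is a convergence determining sequence: `[0,1]`-valued bounded continuous
functions, `F 0 = 1`, such that convergence of all moments `μ(f_k)` implies weak
convergence (for finite positive measures). -/
def IsConvDet (F : ℕ → BoundedContinuousFunction Z ℝ) : Prop :=
  F 0 = 1 ∧ (∀ k x, F k x ∈ Set.Icc (0:ℝ) 1) ∧
  ∀ (μn : ℕ → Measure Z) (μ : Measure Z), (∀ n, IsFiniteMeasure (μn n)) → IsFiniteMeasure μ →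
    (∀ k, Tendsto (fun n => ∫ x, F k x ∂(μn n)) atTop (𝓝 (∫ x, F k x ∂μ))) →
    WeakTendsto μn μ

/-- `‖μ − ν‖_F = Σ_k 2^{-k} |μ(f_k) − ν(f_k)|` for positive measures. -/
def Fdist (F : ℕ → BoundedContinuousFunction Z ℝ) (μ ν : Measure Z) : ℝ :=
  ∑' k : ℕ, (1/2 : ℝ) ^ k * |∫ x, F k x ∂μ - ∫ x, F k x ∂ν|

/-- The cut distance `d_{□,F}(U,W) = ‖U − W‖_{□,F}` on measure-valued kernels. -/
def cutDistF (F : ℕ → BoundedContinuousFunction Z ℝ) (U W : Sq → Measure Z) : ℝ :=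
  ⨆ ST : {p : Set unitInterval × Set unitInterval // MeasurableSet p.1 ∧ MeasurableSet p.2},
    Fdist F (kernelInt U (ST.val.1 ×ˢ ST.val.2)) (kernelInt W (ST.val.1 ×ˢ ST.val.2))

/-- The norm `‖s‖_F` of a signed measure. -/
def FnormS (F : ℕ → BoundedContinuousFunction Z ℝ) (s : SignedMeasure Z) : ℝ :=
  ∑' k : ℕ, (1/2 : ℝ) ^ k * |sint (F k) s|

/-- The cut norm `‖W‖_{□,F}` of a signed measure-valued kernel. -/
def cutNormFS (F : ℕ → BoundedContinuousFunction Z ℝ) (W : Sq → SignedMeasure Z) : ℝ :=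
  ⨆ ST : {p : Set unitInterval × Set unitInterval // MeasurableSet p.1 ∧ MeasurableSet p.2},
    FnormS F (skernelInt W (ST.val.1 ×ˢ ST.val.2))

/-- The norm `‖W‖_{2,F}` of a signed measure-valued kernel. -/
def norm2F (F : ℕ → BoundedContinuousFunction Z ℝ) (W : Sq → SignedMeasure Z) : ℝ :=
  Real.sqrt (∑' k : ℕ, (1/2 : ℝ) ^ k * ∫ p, (sint (F k) (W p)) ^ 2 ∂(volume : Measure Sq))

/-! ### Homomorphism densities and sampling -/

/-- The homomorphism density `t(F^g, W)` of a `C_b(Z)`-decorated finite directed graph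
with vertex set `Fin v` and edge set `E` in a measure-valued kernel `W`. -/
def homDensity {v : ℕ} (E : Finset (Fin v × Fin v))
    (g : Fin v × Fin v → BoundedContinuousFunction Z ℝ) (W : Sq → Measure Z) : ℝ :=
  ∫ x : Fin v → unitInterval,
    (∏ e ∈ E, ∫ z, g e z ∂(W (x e.1, x e.2))) ∂(volume : Measure (Fin v → unitInterval))

/-- The edge set of the complete directed graph on `k` vertices. -/
def completeEdges (k : ℕ) : Finset (Fin k × Fin k) :=
  Finset.univ.filter fun e => e.1 ≠ e.2

/-- The `i`-th step `((i)/k, (i+1)/k]` of the uniform partition of `[0,1]` into `k`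
intervals. -/
def stepSet (k : ℕ) (i : Fin k) : Set unitInterval :=
  {t | (i : ℝ) / k < (t : ℝ) ∧ (t : ℝ) ≤ ((i : ℝ) + 1) / k}

/-- The stepfunction `W_x` sampled from `W` at the points `x = (x₁, …, x_k)`. -/
def sample (W : Sq → Measure Z) {k : ℕ} (x : Fin k → unitInterval) : Sq → Measure Z :=
  fun p => ∑ i : Fin k, ∑ j : Fin k,
    Set.indicator (stepSet k i ×ˢ stepSet k j) (fun _ => W (x i, x j)) p

/-- The probability-graphon associated with the `Z`-weighted complete graph on `k`
vertices with weights `β`. -/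
def graphonOfWeights {k : ℕ} (β : Fin k × Fin k → Z) : Sq → Measure Z :=
  fun p => ∑ i : Fin k, ∑ j : Fin k,
    Set.indicator (stepSet k i ×ˢ stepSet k j) (fun _ => Measure.dirac (β (i, j))) p

/-- The joint law of `(X, (β_{ij}))` where `X` is uniform on `[0,1]^k` and, given `X`,
the weights `β_{ij}` are independent with respective laws `W(X_i, X_j;·)`. -/
def sampleLaw (W : Sq → Measure Z) (k : ℕ) :
    Measure ((Fin k → unitInterval) × (Fin k × Fin k → Z)) :=
  (volume : Measure (Fin k → unitInterval)).bind fun x =>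
    (Measure.pi fun e : Fin k × Fin k => W (x e.1, x e.2)).map (Prod.mk x)

/-! ### Convergence along measure-preserving relabelings -/

/-- Weak convergence of probability measures on a second countable space is implied by
convergence on the members of a fixed sequence of Borel sets. -/
theorem exists_convergenceDetermining_sets [SecondCountableTopology Z]
    [OpensMeasurableSpace Z] :
    ∃ B : ℕ → Set Z, (∀ k, MeasurableSet (B k)) ∧ ∀ (μ : ℕ → Measure Z) (ν : Measure Z),
      (∀ n, IsProbabilityMeasure (μ n)) → IsProbabilityMeasure ν →
      (∀ k, Tendsto (fun n => (μ n).real (B k)) atTop (𝓝 (ν.real (B k)))) →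
      WeakTendsto μ ν := by
  obtain ⟨b, hbc, -, hb⟩ := TopologicalSpace.exists_countable_basis Z
  set S : Set (Set Z) := (fun F : Set (Set Z) => ⋂₀ F) '' {F | F.Finite ∧ F ⊆ b} with hS
  have hSc : S.Countable := (Set.countable_ofPred_finite_subset hbc).image _
  have hSne : S.Nonempty := ⟨_, ∅, ⟨Set.finite_empty, Set.empty_subset _⟩, rfl⟩
  obtain ⟨B, hB⟩ := hSc.exists_eq_range hSne
  have hSm : ∀ s ∈ S, MeasurableSet s := by
    rintro _ ⟨F, ⟨hF, hFb⟩, rfl⟩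
    exact MeasurableSet.sInter hF.countable fun t ht => (hb.isOpen (hFb ht)).measurableSet
  have hpi : IsPiSystem S := by
    rintro _ ⟨F, ⟨hF, hFb⟩, rfl⟩ _ ⟨G, ⟨hG, hGb⟩, rfl⟩ -
    exact ⟨F ∪ G, ⟨hF.union hG, Set.union_subset hFb hGb⟩, Set.sInter_union _ _⟩
  refine ⟨B, fun k => hSm _ (hB ▸ Set.mem_range_self k), fun μ ν hμ hν h f => ?_⟩
  let μ' : ℕ → ProbabilityMeasure Z := fun n => ⟨μ n, hμ n⟩
  let ν' : ProbabilityMeasure Z := ⟨ν, hν⟩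
  have key : Tendsto μ' atTop (𝓝 ν') := by
    refine hpi.tendsto_probabilityMeasure_of_tendsto_of_mem hSm ?_ ?_
    · intro u hu x hx
      obtain ⟨v, hv, hxv, hvu⟩ := hb.exists_subset_of_mem_open hx hu
      exact ⟨v, ⟨{v}, ⟨Set.finite_singleton v, by simpa using hv⟩, Set.sInter_singleton v⟩,
        (hb.isOpen hv).mem_nhds hxv, hvu⟩
    · intro s hs
      rw [hB] at hs
      obtain ⟨k, rfl⟩ := hs
      exact NNReal.tendsto_coe.mp (h k)
  exact ProbabilityMeasure.tendsto_iff_forall_integral_tendsto.mp key f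

/-- Composition with measure-preserving maps is continuous in `L¹` along almost everywhere
convergent sequences of maps. -/
theorem tendsto_eLpNorm_comp_sub {α β : Type*} [MeasurableSpace α] {μ : Measure α}
    [IsFiniteMeasure μ] [TopologicalSpace β] [NormalSpace β] [SecondCountableTopology β]
    [MeasurableSpace β] [BorelSpace β] {ν : Measure β} [IsFiniteMeasure ν] [ν.WeaklyRegular]
    {T : ℕ → α → β} {T' : α → β}
    (hT : ∀ n, MeasurePreserving (T n) μ ν) (hT' : MeasurePreserving T' μ ν)
    (hlim : ∀ᵐ x ∂μ, Tendsto (fun n => T n x) atTop (𝓝 (T' x)))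
    {g : β → ℝ} (hg : MemLp g 1 ν) :
    Tendsto (fun n => eLpNorm (g ∘ T n - g ∘ T') 1 μ) atTop (𝓝 0) := by
  rw [ENNReal.tendsto_nhds_zero]
  intro ε hε
  have hε3 : ε / 3 ≠ 0 := by simp [hε.ne']
  obtain ⟨h, hgh, hh⟩ := hg.exists_boundedContinuous_eLpNorm_sub_le ENNReal.one_ne_top hε3
  have hgm := hg.aestronglyMeasurable
  have hhm := hh.aestronglyMeasurable
  have h1 : ∀ {S : α → β}, MeasurePreserving S μ ν →
      eLpNorm (g ∘ S - h ∘ S) 1 μ ≤ ε / 3 := by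
    intro S hS
    have := eLpNorm_comp_measurePreserving (p := 1) (hgm.sub hhm) hS
    exact (this.trans_le hgh)
  have hmid : Tendsto (fun n => eLpNorm (⇑h ∘ T n - ⇑h ∘ T') 1 μ) atTop (𝓝 0) := by
    simp_rw [eLpNorm_one_eq_lintegral_enorm]
    have hc : Measurable h := h.continuous.measurable
    have := tendsto_lintegral_of_dominated_convergence (μ := μ)
      (F := fun n x => ‖(⇑h ∘ T n - ⇑h ∘ T') x‖ₑ) (f := fun _ => 0)
      (fun _ => ‖h‖ₑ + ‖h‖ₑ) ?_ ?_ ?_ ?_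
    · simpa using this
    · intro n
      exact ((hc.comp (hT n).measurable).sub (hc.comp hT'.measurable)).enorm
    · intro n
      refine Eventually.of_forall fun x => (enorm_sub_le).trans (add_le_add ?_ ?_) <;>
      · simp only [Function.comp, enorm_le_iff_norm_le]
        exact h.norm_coe_le_norm _
    · simp [ENNReal.mul_eq_top]
    · filter_upwards [hlim] with x hx
      have : Tendsto (fun n => h (T n x) - h (T' x)) atTop (𝓝 0) := by
        simpa using ((h.continuous.tendsto _).comp hx).sub_const (h (T' x))
      simpa using this.enorm
  filter_upwards [ENNReal.tendsto_nhds_zero.mp hmid (ε / 3) (pos_iff_ne_zero.mpr hε3)] with n hn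
  have hTn := (hT n)
  have e : g ∘ T n - g ∘ T' =
      (g ∘ T n - ⇑h ∘ T n) + ((⇑h ∘ T n - ⇑h ∘ T') + (⇑h ∘ T' - g ∘ T')) := by
    ext x; simp
  have m1 := hgm.comp_measurePreserving hTn
  have m2 := hhm.comp_measurePreserving hTn
  have m3 := hgm.comp_measurePreserving hT'
  have m4 := hhm.comp_measurePreserving hT'
  rw [e]
  calc _ ≤ _ := eLpNorm_add_le (m1.sub m2) ((m2.sub m4).add (m4.sub m3)) le_rfl
    _ ≤ ε / 3 + (ε / 3 + ε / 3) := by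
      refine add_le_add (h1 hTn) ((eLpNorm_add_le (m2.sub m4) (m4.sub m3) le_rfl).trans
        (add_le_add hn ?_))
      rw [eLpNorm_sub_comm]
      exact h1 hT'
    _ = ε := by rw [← add_assoc, ENNReal.add_thirds]

/-- Countably many sequences converging in `L¹` have a common almost everywhere convergent
subsequence. -/
theorem exists_common_subseq_tendsto_ae {α : Type*} [MeasurableSpace α] {μ : Measure α}
    {f : ℕ → ℕ → α → ℝ} {g : ℕ → α → ℝ}
    (hm : ∀ k n, AEStronglyMeasurable (f k n - g k) μ)
    (h : ∀ k, Tendsto (fun n => eLpNorm (f k n - g k) 1 μ) atTop (𝓝 0)) :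
    ∃ ns : ℕ → ℕ, StrictMono ns ∧
      ∀ᵐ x ∂μ, ∀ k, Tendsto (fun j => f k (ns j) x) atTop (𝓝 (g k x)) := by
  obtain ⟨ns, hns, hle⟩ := extraction_forall_of_eventually
    (P := fun j n => ∀ k ∈ Set.Iic j, eLpNorm (f k n - g k) 1 μ ≤ 2⁻¹ ^ j) (fun j => by
      rw [eventually_all_finite (Set.finite_Iic j)]
      intro k _
      exact ENNReal.tendsto_nhds_zero.mp (h k) _ (ENNReal.pow_pos (by simp) j))
  refine ⟨ns, hns, ae_all_iff.mpr fun k => ?_⟩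
  have hsum : ∫⁻ x, ∑' j, ‖(f k (ns (j + k)) - g k) x‖ₑ ∂μ ≠ ∞ := by
    rw [lintegral_tsum fun j => (hm k _).enorm]
    refine ne_top_of_le_ne_top (b := ∑' j : ℕ, (2⁻¹ : ℝ≥0∞) ^ j) (by simp) ?_
    refine ENNReal.tsum_le_tsum fun j => ?_
    rw [← eLpNorm_one_eq_lintegral_enorm]
    refine (hle (j + k) k (by simp)).trans ?_
    exact pow_le_pow_right_of_le_one' (by simp) (by simp)
  have hae := ae_lt_top' (AEMeasurable.tsum fun j => (hm k (ns (j + k))).enorm) hsum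
  filter_upwards [hae] with x hx
  have h0 := ENNReal.tendsto_atTop_zero_of_tsum_ne_top hx.ne
  rw [← tendsto_add_atTop_iff_nat k, tendsto_iff_edist_tendsto_0]
  simpa [edist_eq_enorm_sub] using h0

theorem IsMP.prodMap {φ : unitInterval → unitInterval} (hφ : IsMP φ) :
    MeasurePreserving (fun p : Sq => (φ p.1, φ p.2)) volume volume :=
  MeasurePreserving.prod hφ hφ

theorem IsProbGraphon.relabel {Y : Type*} [MeasurableSpace Y] {W : Sq → Measure Y}
    (hW : IsProbGraphon W) {φ : unitInterval → unitInterval} (hφ : IsMP φ) :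
    IsProbGraphon (relabel W φ) :=
  ⟨fun A hA => (hW.1 A hA).comp hφ.prodMap.measurable, fun _ => hW.2 _⟩

theorem Smooth.tendsto_relabel [SecondCountableTopology Z] [OpensMeasurableSpace Z]
    {d : (Sq → Measure Z) → (Sq → Measure Z) → ℝ} (hd : Smooth d)
    {U : Sq → Measure Z} (hU : IsProbGraphon U)
    {τ : ℕ → unitInterval → unitInterval} {τ' : unitInterval → unitInterval}
    (hτ : ∀ n, IsMP (τ n)) (hτ' : IsMP τ')
    (hlim : ∀ᵐ x, Tendsto (fun n => τ n x) atTop (𝓝 (τ' x))) :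
    Tendsto (fun n => d (relabel U (τ n)) (relabel U τ')) atTop (𝓝 0) := by
  refine tendsto_of_subseq_tendsto fun ms hms => ?_
  obtain ⟨B, hBm, hB⟩ := exists_convergenceDetermining_sets (Z := Z)
  have hgm : ∀ k, Measurable fun p => (U p).real (B k) :=
    fun k => (hU.1 _ (hBm k)).ennreal_toReal
  have hg : ∀ k, MemLp (fun p => (U p).real (B k)) 1 (volume : Measure Sq) := by
    intro k
    refine MemLp.of_bound (hgm k).aestronglyMeasurable 1 (Eventually.of_forall fun p => ?_)
    have := hU.2 p
    rw [Real.norm_of_nonneg measureReal_nonneg]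
    exact measureReal_le_one
  have hlim2 : ∀ᵐ p : Sq, Tendsto (fun n => (τ (ms n) p.1, τ (ms n) p.2)) atTop
      (𝓝 (τ' p.1, τ' p.2)) := by
    have a1 := (Measure.quasiMeasurePreserving_fst (μ := (volume : Measure unitInterval))
      (ν := (volume : Measure unitInterval))).ae hlim
    have a2 := (Measure.quasiMeasurePreserving_snd (μ := (volume : Measure unitInterval))
      (ν := (volume : Measure unitInterval))).ae hlim
    filter_upwards [a1, a2] with p h1 h2
    exact (h1.comp hms).prodMk_nhds (h2.comp hms)
  have hL1 := fun k => tendsto_eLpNorm_comp_sub (fun n => (hτ (ms n)).prodMap) hτ'.prodMap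
    hlim2 (hg k)
  obtain ⟨ns, hns, hae⟩ := exists_common_subseq_tendsto_ae
    (fun k n => (((hgm k).comp (hτ (ms n)).prodMap.measurable).sub
      ((hgm k).comp hτ'.prodMap.measurable)).aestronglyMeasurable) hL1
  refine ⟨ns, hd _ _ (fun n => hU.relabel (hτ _)) (hU.relabel hτ') ?_⟩
  filter_upwards [hae] with p hp
  exact hB _ _ (fun _ => hU.2 _) (hU.2 _) hp

/-! ### Measure-preserving bijections of the unit interval -/

open scoped Pointwise in
theorem volume_cantorSet : volume cantorSet = 0 := by
  have himg : ∀ a : ℝ, volume ((fun x => (a + x) / 3) '' cantorSet) =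
      ENNReal.ofReal (1 / 3) * volume cantorSet := by
    intro a
    have : (fun x : ℝ => (a + x) / 3) '' cantorSet = ((a / 3) +ᵥ ((1 / 3 : ℝ) • cantorSet)) := by
      ext y
      simp only [Set.mem_image, Set.mem_vadd_set, Set.mem_smul_set, vadd_eq_add, smul_eq_mul]
      constructor
      · rintro ⟨x, hx, rfl⟩
        exact ⟨1 / 3 * x, ⟨x, hx, rfl⟩, by ring⟩
      · rintro ⟨_, ⟨x, hx, rfl⟩, rfl⟩
        exact ⟨x, hx, by ring⟩
    rw [this, measure_vadd, Measure.addHaar_smul]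
    simp
  have hfin : volume cantorSet ≠ ∞ := isCompact_cantorSet.measure_lt_top.ne
  have h0 := himg 0
  simp only [zero_add] at h0
  have hle : volume cantorSet ≤
      ENNReal.ofReal (1 / 3) * volume cantorSet + ENNReal.ofReal (1 / 3) * volume cantorSet := by
    conv_lhs => rw [cantorSet_eq_union_halves]
    refine (measure_union_le _ _).trans ?_
    rw [h0, himg 2]
  have hr := ENNReal.toReal_mono (by finiteness) hle
  rw [ENNReal.toReal_add (by finiteness) (by finiteness), ENNReal.toReal_mul,
    ENNReal.toReal_ofReal (by norm_num)] at hr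
  have hz : (volume cantorSet).toReal = 0 := by
    linarith [ENNReal.toReal_nonneg (a := volume cantorSet)]
  exact ((ENNReal.toReal_eq_zero_iff _).mp hz).resolve_right hfin

theorem exists_uncountable_null_set :
    ∃ N : Set unitInterval, MeasurableSet N ∧ volume N = 0 ∧ ¬ N.Countable := by
  refine ⟨Subtype.val ⁻¹' cantorSet, measurable_subtype_coe isClosed_cantorSet.measurableSet,
    ?_, fun hc => ?_⟩
  · rw [unitInterval.volume_apply]
    exact measure_mono_null (Set.image_preimage_subset _ _) volume_cantorSet
  · have himg : Subtype.val '' (Subtype.val ⁻¹' cantorSet : Set unitInterval) = cantorSet := by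
      rw [Set.image_preimage_eq_iff, Subtype.range_coe]
      exact cantorSet_subset_unitInterval
    have hC : cantorSet.Countable := himg ▸ hc.image Subtype.val
    have : Countable cantorSet := hC
    have hcount : Countable (ℕ → Bool) := cantorSetHomeomorphNatToBool.symm.injective.countable
    rw [← Cardinal.mk_le_aleph0_iff] at hcount
    simpa using hcount.trans_lt (Cardinal.cantor Cardinal.aleph0)

/-- An almost everywhere injective measure-preserving map of the unit interval agrees almost
everywhere with a measure-preserving bijection. -/
theorem IsMP.exists_bijective_ae_eq {ψ : unitInterval → unitInterval} (hψ : IsMP ψ)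
    {G : Set unitInterval} (hG : MeasurableSet G) (hGnull : volume Gᶜ = 0)
    (hinj : Set.InjOn ψ G) :
    ∃ ψ' : unitInterval → unitInterval, IsMP ψ' ∧ Function.Bijective ψ' ∧ ψ' =ᵐ[volume] ψ := by
  classical
  obtain ⟨N, hN, hN0, hNunc⟩ := exists_uncountable_null_set
  set G' : Set unitInterval := G ∩ (Nᶜ ∩ ψ ⁻¹' Nᶜ) with hG'
  have hG'm : MeasurableSet G' := hG.inter (hN.compl.inter (hψ.measurable hN.compl))
  have hG'null : volume G'ᶜ = 0 := by
    have : G'ᶜ = Gᶜ ∪ (N ∪ ψ ⁻¹' N) := by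
      simp only [hG', Set.compl_inter, compl_compl, Set.preimage_compl]
    rw [this]
    exact measure_union_null hGnull (measure_union_null hN0
      ((hψ.measure_preimage hN.nullMeasurableSet).trans hN0))
  have hinj' : Set.InjOn ψ G' := hinj.mono Set.inter_subset_left
  have him : MeasurableSet (ψ '' G') := hG'm.image_of_measurable_injOn hψ.measurable hinj'
  have hunc1 : ¬ Countable ↥(G'ᶜ) := fun h =>
    hNunc ((Set.countable_coe_iff.mp h).mono (by intro x hx hx'; exact hx'.2.1 hx))
  have hunc2 : ¬ Countable ↥((ψ '' G')ᶜ) := fun h =>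
    hNunc ((Set.countable_coe_iff.mp h).mono (by rintro x hx ⟨y, hy, rfl⟩; exact hy.2.2 hx))
  have := hG'm.compl.standardBorel
  have := him.compl.standardBorel
  let e : ↥(G'ᶜ) ≃ᵐ ↥((ψ '' G')ᶜ) := PolishSpace.measurableEquivOfNotCountable hunc1 hunc2
  let ψ' : unitInterval → unitInterval := fun x =>
    if h : x ∈ G' then ψ x else (e ⟨x, h⟩ : unitInterval)
  have h_in : ∀ {x}, x ∈ G' → ψ' x = ψ x := fun {x} h => dif_pos h
  have h_out : ∀ {x} (h : x ∈ G'ᶜ), ψ' x = (e ⟨x, h⟩ : unitInterval) := fun {x} h => dif_neg h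
  have hm : Measurable ψ' :=
    Measurable.dite (s := G') (f := fun x => ψ x) (g := fun x => (e x : unitInterval))
      (hψ.measurable.comp measurable_subtype_coe)
      (measurable_subtype_coe.comp e.measurable) hG'm
  have hae : ψ' =ᵐ[volume] ψ := by
    have : ∀ᵐ x, x ∈ G' := hG'null
    filter_upwards [this] with x hx using h_in hx
  refine ⟨ψ', ⟨hm, (Measure.map_congr hae).trans hψ.map_eq⟩, ⟨fun x y hxy => ?_, fun y => ?_⟩, hae⟩
  · by_cases hx : x ∈ G' <;> by_cases hy : y ∈ G'
    · rw [h_in hx, h_in hy] at hxy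
      exact hinj' hx hy hxy
    · rw [h_in hx, h_out hy] at hxy
      exact absurd ⟨x, hx, hxy⟩ (e ⟨y, hy⟩).2
    · rw [h_out hx, h_in hy] at hxy
      exact absurd ⟨y, hy, hxy.symm⟩ (e ⟨x, hx⟩).2
    · rw [h_out hx, h_out hy] at hxy
      simpa using e.injective (Subtype.ext hxy)
  · by_cases hy : y ∈ ψ '' G'
    · obtain ⟨x, hx, rfl⟩ := hy
      exact ⟨x, h_in hx⟩
    · refine ⟨e.symm ⟨y, hy⟩, ?_⟩
      rw [h_out (e.symm ⟨y, hy⟩).2]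
      simp

/-- The cumulative distribution function of a measure on the unit interval. -/
def intervalCdf (ν : Measure unitInterval) [IsProbabilityMeasure ν] (x : unitInterval) :
    unitInterval :=
  ⟨ν.real (Set.Iic x), measureReal_nonneg, measureReal_le_one⟩

/-- The quantile function of a measure on the unit interval. -/
def quantile (ν : Measure unitInterval) [IsProbabilityMeasure ν] (t : unitInterval) :
    unitInterval :=
  sInf {x | t ≤ intervalCdf ν x}

section Quantile

variable (ν : Measure unitInterval) [IsProbabilityMeasure ν]

theorem monotone_intervalCdf : Monotone (intervalCdf ν) := fun _ _ h =>
  measureReal_mono (Set.Iic_subset_Iic.mpr h)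

theorem le_intervalCdf_quantile (t : unitInterval) : t ≤ intervalCdf ν (quantile ν t) := by
  set S := {x | t ≤ intervalCdf ν x} with hS
  have hne : S.Nonempty := ⟨1, by
    have : Set.Iic (1 : unitInterval) = Set.univ := Set.Iic_top
    simp only [hS, Set.mem_ofPred_eq, ← Subtype.coe_le_coe, intervalCdf, this, probReal_univ]
    exact t.2.2⟩
  obtain ⟨u, hu, hlim, hmem⟩ := exists_seq_tendsto_sInf hne (OrderBot.bddBelow S)
  have hI : Set.Iic (sInf S) = ⋂ n, Set.Iic (u n) := by
    ext x
    simp only [Set.mem_Iic, Set.mem_iInter]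
    exact ⟨fun h n => h.trans (sInf_le (hmem n)), fun h => ge_of_tendsto' hlim h⟩
  have ht := tendsto_measure_iInter_atTop (μ := ν) (s := fun n => Set.Iic (u n))
    (fun n => measurableSet_Iic.nullMeasurableSet)
    (fun m n h => Set.Iic_subset_Iic.mpr (hu h)) ⟨0, by finiteness⟩
  rw [← hI] at ht
  have ht' := (ENNReal.tendsto_toReal (measure_ne_top ν _)).comp ht
  rw [← Subtype.coe_le_coe]
  exact ge_of_tendsto' ht' fun n => hmem n

theorem gc_quantile_intervalCdf : GaloisConnection (quantile ν) (intervalCdf ν) := fun t _ =>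
  ⟨fun h => (le_intervalCdf_quantile ν t).trans (monotone_intervalCdf ν h), fun h => sInf_le h⟩

theorem map_quantile : Measure.map (quantile ν) volume = ν := by
  have hm : Measurable (quantile ν) := (gc_quantile_intervalCdf ν).monotone_l.measurable
  have : IsFiniteMeasure (Measure.map (quantile ν) volume) := inferInstance
  refine Measure.ext_of_Iic _ _ fun x => ?_
  have : quantile ν ⁻¹' Set.Iic x = Set.Iic (intervalCdf ν x) := by
    ext t; exact gc_quantile_intervalCdf ν t x
  rw [Measure.map_apply hm measurableSet_Iic, this, unitInterval.volume_Iic]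
  simp [intervalCdf]

theorem measurePreserving_quantile : MeasurePreserving (quantile ν) volume ν :=
  ⟨(gc_quantile_intervalCdf ν).monotone_l.measurable, map_quantile ν⟩

theorem intervalCdf_quantile [NullSingletonClass ν] (t : unitInterval) :
    intervalCdf ν (quantile ν t) = t := by
  refine le_antisymm ?_ (le_intervalCdf_quantile ν t)
  have hsub : quantile ν ⁻¹' Set.Iio (quantile ν t) ⊆ Set.Iio t :=
    fun s hs => (gc_quantile_intervalCdf ν).monotone_l.reflect_lt hs
  have hle : ν (Set.Iic (quantile ν t)) ≤ ENNReal.ofReal t := by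
    rw [← measure_congr Iio_ae_eq_Iic,
      ← (measurePreserving_quantile ν).measure_preimage measurableSet_Iio.nullMeasurableSet]
    exact (measure_mono hsub).trans_eq (unitInterval.volume_Iio t)
  exact ENNReal.toReal_le_of_le_ofReal t.2.1 hle

end Quantile

/-- The distribution transform of an injective map agrees almost everywhere with a
measure-preserving bijection. -/
theorem exists_bijective_ae_eq_intervalCdf {h : unitInterval → unitInterval} (hm : Measurable h)
    (hinj : Function.Injective h) :
    ∃ ψ : unitInterval → unitInterval, IsMP ψ ∧ Function.Bijective ψ ∧
      ∀ᵐ x, (ψ x : ℝ) = (volume : Measure unitInterval).real {y | h y ≤ h x} := by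
  let ν : Measure unitInterval := Measure.map h volume
  have : IsProbabilityMeasure ν := Measure.isProbabilityMeasure_map hm.aemeasurable
  have hat : NullSingletonClass ν := ⟨fun x => by
    rw [Measure.map_apply hm (measurableSet_singleton x)]
    exact (Set.subsingleton_singleton.preimage hinj).measure_zero _⟩
  have hQ := measurePreserving_quantile ν
  have hF : MeasurePreserving (intervalCdf ν) ν volume := by
    refine ⟨(monotone_intervalCdf ν).measurable, ?_⟩
    have e := Measure.map_map (μ := volume) (monotone_intervalCdf ν).measurable hQ.measurable
    rwa [hQ.map_eq, show intervalCdf ν ∘ quantile ν = id from funext (intervalCdf_quantile ν),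
      Measure.map_id] at e
  have hh : MeasurePreserving h volume ν := ⟨hm, rfl⟩
  have hψ : IsMP (intervalCdf ν ∘ h) := hF.comp hh
  let G : Set unitInterval := {x | quantile ν (intervalCdf ν (h x)) = h x}
  have hS : MeasurableSet {z | quantile ν (intervalCdf ν z) = z} :=
    measurableSet_eq_fun (hQ.measurable.comp hF.measurable) measurable_id
  have hGnull : volume Gᶜ = 0 := by
    have h1 : ∀ᵐ z ∂ν, quantile ν (intervalCdf ν z) = z := by
      have h2 := (ae_map_iff (μ := volume) hQ.measurable.aemeasurable hS).mpr
        (Eventually.of_forall fun t => by rw [intervalCdf_quantile])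
      rwa [hQ.map_eq] at h2
    exact hh.quasiMeasurePreserving.ae h1
  obtain ⟨ψ, h1, h2, h3⟩ := hψ.exists_bijective_ae_eq (hm hS) hGnull (by
    intro x hx y hy hxy
    refine hinj ?_
    rw [← show quantile ν (intervalCdf ν (h x)) = h x from hx,
      ← show quantile ν (intervalCdf ν (h y)) = h y from hy]
    exact congrArg _ hxy)
  refine ⟨ψ, h1, h2, ?_⟩
  filter_upwards [h3] with x hx
  rw [hx]
  exact map_measureReal_apply hm measurableSet_Iic

/-- Measure-preserving maps of the unit interval are almost everywhere limits of
measure-preserving bijections. -/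
theorem IsMP.exists_seq_bijective_tendsto {φ : unitInterval → unitInterval} (hφ : IsMP φ) :
    ∃ φn : ℕ → unitInterval → unitInterval, (∀ n, IsMP (φn n) ∧ Function.Bijective (φn n)) ∧
      ∀ᵐ x, Tendsto (fun n => φn n x) atTop (𝓝 (φ x)) := by
  have key : ∀ n : ℕ, ∃ ψ : unitInterval → unitInterval, (IsMP ψ ∧ Function.Bijective ψ) ∧
      ∀ᵐ x, dist (ψ x) (φ x) ≤ 1 / ((n : ℝ) + 1) := by
    intro n
    let m : ℝ := (n : ℝ) + 1
    have hm0 : 0 < m := by positivity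
    let k : unitInterval → ℕ := fun x => ⌊m * φ x⌋₊
    have hkm : Measurable k :=
      Nat.measurable_floor.comp (measurable_const.mul hφ.measurable.subtype_val)
    have hk_le : ∀ x, (k x : ℝ) ≤ m * φ x := fun x =>
      Nat.floor_le (mul_nonneg hm0.le (φ x).2.1)
    have hk_lt : ∀ x, m * φ x < k x + 1 := fun x => Nat.lt_floor_add_one _
    have hk_m : ∀ x, (k x : ℝ) ≤ m := fun x =>
      (hk_le x).trans (mul_le_of_le_one_right hm0.le (φ x).2.2)
    let h : unitInterval → unitInterval := fun x =>
      ⟨(k x + (x : ℝ) / 2) / (m + 1), by have := x.2.1; positivity, by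
        rw [div_le_one (by positivity)]
        linarith [hk_m x, x.2.2]⟩
    have hhm : Measurable h :=
      Measurable.subtype_mk (((measurable_from_nat.comp hkm).add
        (measurable_subtype_coe.div_const 2)).div_const _)
    have h_le : ∀ {x y}, h x ≤ h y ↔ (k x + (x : ℝ) / 2) ≤ k y + (y : ℝ) / 2 := by
      intro x y
      rw [← Subtype.coe_le_coe]
      exact div_le_div_iff_of_pos_right (by positivity)
    have k_le : ∀ {x y}, h x ≤ h y → k x ≤ k y := by
      intro x y hxy
      rw [h_le] at hxy
      by_contra! hlt
      have : (k y : ℝ) + 1 ≤ k x := by exact_mod_cast hlt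
      linarith [x.2.1, y.2.2]
    have h_lt : ∀ {x y}, k x < k y → h x ≤ h y := by
      intro x y hxy
      by_contra! hlt
      exact absurd (k_le hlt.le) (not_le.mpr hxy)
    have hinj : Function.Injective h := by
      intro x y hxy
      have hk : k x = k y := le_antisymm (k_le hxy.le) (k_le hxy.ge)
      have h1 := h_le.mp hxy.le
      have h2 := h_le.mp hxy.ge
      rw [hk] at h1 h2
      exact Subtype.ext (by linarith)
    obtain ⟨ψ, hψ, hbij, hψe⟩ := exists_bijective_ae_eq_intervalCdf hhm hinj
    refine ⟨ψ, ⟨hψ, hbij⟩, ?_⟩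
    filter_upwards [hψe] with x hx
    rw [Subtype.dist_eq, Real.dist_eq, hx, abs_sub_le_iff]
    have hx1 := hk_le x
    have hx2 := hk_lt x
    have hupper : (volume : Measure unitInterval).real {y | h y ≤ h x} ≤ (k x + 1) / m := by
      have hsub : {y | h y ≤ h x} ⊆ φ ⁻¹' {u | m * (u : ℝ) ≤ k x + 1} := by
        intro y hy
        have : (k y : ℝ) ≤ k x := by exact_mod_cast k_le hy
        exact ((hk_lt y).trans_le (by linarith)).le
      have hms : MeasurableSet {u : unitInterval | m * (u : ℝ) ≤ k x + 1} :=
        measurableSet_le (measurable_subtype_coe.const_mul m) measurable_const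
      refine (measureReal_mono hsub).trans ?_
      rw [measureReal_def, hφ.measure_preimage hms.nullMeasurableSet, unitInterval.volume_apply]
      refine ENNReal.toReal_le_of_le_ofReal (by positivity) ?_
      rw [← sub_zero ((k x + 1) / m), ← Real.volume_Icc]
      refine measure_mono ?_
      rintro _ ⟨u, hu, rfl⟩
      exact ⟨u.2.1, (le_div_iff₀' hm0).mpr hu⟩
    have hlower : k x / m ≤ (volume : Measure unitInterval).real {y | h y ≤ h x} := by
      let c : unitInterval := ⟨k x / m, by positivity, (div_le_one hm0).mpr (hk_m x)⟩
      have hsub : φ ⁻¹' Set.Iio c ⊆ {y | h y ≤ h x} := by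
        intro y hy
        refine h_lt ?_
        have h1 : (φ y : ℝ) < k x / m := hy
        rw [lt_div_iff₀' hm0] at h1
        exact_mod_cast (hk_le y).trans_lt h1
      refine le_of_eq_of_le ?_ (measureReal_mono hsub)
      rw [measureReal_def, hφ.measure_preimage measurableSet_Iio.nullMeasurableSet,
        unitInterval.volume_Iio, ENNReal.toReal_ofReal c.2.1]
    have h1 : (k x : ℝ) / m ≤ φ x := (div_le_iff₀' hm0).mpr hx1
    have h2 : (φ x : ℝ) ≤ (k x + 1) / m := (le_div_iff₀' hm0).mpr hx2.le
    rw [add_div] at hupper h2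
    exact ⟨by linarith, by linarith⟩
  choose φn hφn hdist using key
  refine ⟨φn, hφn, ?_⟩
  filter_upwards [ae_all_iff.mpr hdist] with x hx
  rw [tendsto_iff_dist_tendsto_zero]
  exact squeeze_zero (fun _ => dist_nonneg) hx tendsto_one_div_add_atTop_nhds_zero_nat

/-! ### Compactness of couplings -/

theorem exists_continuous_surjective_unitInterval_square :
    ∃ c : unitInterval → Sq, Continuous c ∧ Function.Surjective c := by
  obtain ⟨f, hf, hsurj⟩ := exists_nat_bool_continuous_surjective_of_compact Sq
  let f' : C(cantorSet, Sq) :=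
    ⟨f ∘ cantorSetHomeomorphNatToBool, hf.comp cantorSetHomeomorphNatToBool.continuous⟩
  obtain ⟨g, hg⟩ := ContinuousMap.exists_restrict_eq isClosed_cantorSet f'
  refine ⟨fun x => g x, g.continuous.comp continuous_subtype_val, fun y => ?_⟩
  obtain ⟨x, rfl⟩ := (hsurj.comp cantorSetHomeomorphNatToBool.surjective) y
  exact ⟨⟨x, cantorSet_subset_unitInterval x.2⟩, DFunLike.congr_fun hg x⟩

/-- A continuous surjection from the unit interval onto a Hausdorff space has a Borel section. -/
theorem exists_measurable_section {X : Type*} [TopologicalSpace X] [T2Space X]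
    [MeasurableSpace X] [BorelSpace X] {c : unitInterval → X} (hc : Continuous c)
    (hsurj : Function.Surjective c) :
    ∃ s : X → unitInterval, Measurable s ∧ ∀ y, c (s y) = y := by
  have hmem : ∀ y, c (sInf (c ⁻¹' {y})) = y := fun y =>
    IsClosed.sInf_mem (hsurj y) (isClosed_singleton.preimage hc)
  refine ⟨fun y => sInf (c ⁻¹' {y}), measurable_of_Iic fun a => ?_, hmem⟩
  have : (fun y => sInf (c ⁻¹' {y})) ⁻¹' Set.Iic a = c '' Set.Iic a := by
    ext y
    constructor
    · exact fun h => ⟨_, h, hmem y⟩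
    · rintro ⟨x, hx, rfl⟩
      exact (sInf_le (show x ∈ c ⁻¹' {c x} from rfl)).trans hx
  rw [this]
  exact (isClosed_Iic.isCompact.image hc).measurableSet

/-- **Helly's selection theorem** on the unit interval. -/
theorem exists_subseq_tendsto_of_monotone {Q : ℕ → unitInterval → unitInterval}
    (hQ : ∀ n, Monotone (Q n)) :
    ∃ (ns : ℕ → ℕ) (Q' : unitInterval → unitInterval), StrictMono ns ∧ Monotone Q' ∧
      ∀ᵐ t, Tendsto (fun j => Q (ns j) t) atTop (𝓝 (Q' t)) := by
  obtain ⟨D, hDc, hD⟩ := TopologicalSpace.exists_countable_dense unitInterval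
  have : Countable D := hDc
  obtain ⟨g, ns, hns, hlim⟩ := CompactSpace.tendsto_subseq (fun n (q : D) => Q n q)
  rw [tendsto_pi_nhds] at hlim
  let Q' : unitInterval → unitInterval := fun t => sSup (g '' {q | (q : unitInterval) ≤ t})
  have hQ' : Monotone Q' := fun s t hst => sSup_le_sSup (Set.image_mono fun q hq => hq.trans hst)
  have hgQ : ∀ q : D, g q ≤ Q' q := fun q => le_sSup ⟨q, le_refl (q : unitInterval), rfl⟩
  refine ⟨ns, Q', hns, hQ', ?_⟩
  filter_upwards [hQ'.countable_not_continuousAt.ae_notMem volume,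
    (Set.countable_singleton (1 : unitInterval)).ae_notMem volume] with t ht ht1
  have hcont : ContinuousAt Q' t := not_not.mp ht
  have hlt1 : t < 1 := lt_of_le_of_ne t.2.2 ht1
  rw [tendsto_order]
  constructor
  · intro a ha
    obtain ⟨_, ⟨q, hq, rfl⟩, haq⟩ := lt_sSup_iff.mp ha
    filter_upwards [(hlim q).eventually_const_lt haq] with j hj
    exact hj.trans_le (hQ _ hq)
  · intro b hb
    have hev : ∀ᶠ s in 𝓝 t, Q' s < b := hcont.eventually_lt_const hb
    obtain ⟨u, hu, hub⟩ := exists_Ico_subset_of_mem_nhds hev ⟨1, hlt1⟩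
    obtain ⟨q, hqD, hq⟩ := hD.exists_between hu
    have : g ⟨q, hqD⟩ < b := (hgQ ⟨q, hqD⟩).trans_lt (hub ⟨hq.1.le, hq.2⟩)
    filter_upwards [(hlim ⟨q, hqD⟩).eventually_lt_const this] with j hj
    exact (hQ _ hq.1.le).trans_lt hj

theorem isMP_of_tendsto_ae {τ : ℕ → unitInterval → unitInterval} {τ' : unitInterval → unitInterval}
    (hτ : ∀ n, IsMP (τ n)) (hm : Measurable τ')
    (hlim : ∀ᵐ x, Tendsto (fun n => τ n x) atTop (𝓝 (τ' x))) : IsMP τ' := by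
  refine ⟨hm, ?_⟩
  have := Measure.isProbabilityMeasure_map (μ := (volume : Measure unitInterval)) hm.aemeasurable
  refine ext_of_forall_integral_eq_of_IsFiniteMeasure fun f => ?_
  rw [integral_map hm.aemeasurable f.continuous.aestronglyMeasurable]
  have h1 : Tendsto (fun n => ∫ x, f (τ n x)) atTop (𝓝 (∫ x, f (τ' x))) := by
    refine tendsto_integral_of_dominated_convergence (fun _ => ‖f‖) (fun n => ?_)
      (integrable_const _) (fun n => Eventually.of_forall fun x => f.norm_coe_le_norm _) ?_
    · exact (f.continuous.measurable.comp (hτ n).measurable).aestronglyMeasurable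
    · filter_upwards [hlim] with x hx using (f.continuous.tendsto _).comp hx
  have h2 : ∀ n, ∫ x, f (τ n x) = ∫ x, f x := fun n => by
    conv_rhs => rw [← (hτ n).map_eq]
    rw [integral_map (hτ n).measurable.aemeasurable f.continuous.aestronglyMeasurable]
  simp_rw [h2] at h1
  exact tendsto_nhds_unique h1 tendsto_const_nhds

/-- Graphs of measure-preserving maps admit, along a subsequence, almost everywhere convergent
measure-preserving parametrizations. -/
theorem exists_subseq_parametrization_tendsto {φ : ℕ → unitInterval → unitInterval}
    (hφ : ∀ n, IsMP (φ n)) :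
    ∃ (ns : ℕ → ℕ) (α : ℕ → unitInterval → unitInterval) (α' β' : unitInterval → unitInterval),
      StrictMono ns ∧ (∀ j, IsMP (α j)) ∧ IsMP α' ∧ IsMP β' ∧
      (∀ᵐ t, Tendsto (fun j => α j t) atTop (𝓝 (α' t))) ∧
      ∀ᵐ t, Tendsto (fun j => φ (ns j) (α j t)) atTop (𝓝 (β' t)) := by
  obtain ⟨c, hc, hsurj⟩ := exists_continuous_surjective_unitInterval_square
  obtain ⟨s, hs, hcs⟩ := exists_measurable_section hc hsurj
  have hh : ∀ n, Measurable fun x => s (x, φ n x) := fun n =>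
    hs.comp (measurable_id.prodMk (hφ n).measurable)
  let ν : ℕ → Measure unitInterval := fun n => Measure.map (fun x => s (x, φ n x)) volume
  have hν : ∀ n, IsProbabilityMeasure (ν n) := fun n =>
    Measure.isProbabilityMeasure_map (hh n).aemeasurable
  have hQ := fun n => measurePreserving_quantile (ν n)
  have hc1 : Measurable fun z => (c z).1 := hc.measurable.fst
  have hc2 : Measurable fun z => (c z).2 := hc.measurable.snd
  have hgraph : ∀ n, ∀ᵐ t, (c (quantile (ν n) t)).2 = φ n (c (quantile (ν n) t)).1 := by
    intro n
    refine (hQ n).quasiMeasurePreserving.ae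
      (p := fun z => (c z).2 = φ n (c z).1) ?_
    exact (ae_map_iff (hh n).aemeasurable
      (measurableSet_eq_fun hc2 ((hφ n).measurable.comp hc1))).mpr
      (Eventually.of_forall fun x => by simp [hcs])
  have hα : ∀ n, IsMP fun t => (c (quantile (ν n) t)).1 := by
    intro n
    have h1 : MeasurePreserving (fun z => (c z).1) (ν n) volume := by
      refine ⟨hc1, ?_⟩
      rw [Measure.map_map hc1 (hh n)]
      have : ((fun z => (c z).1) ∘ fun x => s (x, φ n x)) = id := by
        ext x; simp [hcs]
      rw [this, Measure.map_id]
    exact h1.comp (hQ n)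
  obtain ⟨ns, Q', hns, hQ'm, hlim⟩ := exists_subseq_tendsto_of_monotone
    fun n => (gc_quantile_intervalCdf (ν n)).monotone_l
  have hlim1 : ∀ᵐ t, Tendsto (fun j => (c (quantile (ν (ns j)) t)).1) atTop
      (𝓝 (c (Q' t)).1) := by
    filter_upwards [hlim] with t ht using ((continuous_fst.comp hc).tendsto _).comp ht
  have hlim2 : ∀ᵐ t, Tendsto (fun j => φ (ns j) (c (quantile (ν (ns j)) t)).1) atTop
      (𝓝 (c (Q' t)).2) := by
    filter_upwards [hlim, ae_all_iff.mpr hgraph] with t ht hg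
    simp_rw [← hg]
    exact ((continuous_snd.comp hc).tendsto _).comp ht
  exact ⟨ns, fun j t => (c (quantile (ν (ns j)) t)).1, fun t => (c (Q' t)).1,
    fun t => (c (Q' t)).2, hns, fun j => hα _,
    isMP_of_tendsto_ae (fun j => hα (ns j)) (hc1.comp hQ'm.measurable) hlim1,
    isMP_of_tendsto_ae (fun j => (hφ (ns j)).comp (hα (ns j))) (hc2.comp hQ'm.measurable) hlim2,
    hlim1, hlim2⟩

theorem isMP_id : IsMP id := MeasurePreserving.id volume

theorem IsMP.exists_bijective_inverse {φ : unitInterval → unitInterval} (hφ : IsMP φ)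
    (hb : Function.Bijective φ) : ∃ ψ : unitInterval → unitInterval,
      (IsMP ψ ∧ Function.Bijective ψ) ∧ φ ∘ ψ = id ∧ ψ ∘ φ = id := by
  have he : MeasurableEmbedding φ := hφ.measurable.measurableEmbedding hb.injective
  let e := Equiv.ofBijective φ hb
  have hsymm : Measurable e.symm := fun s hs => by
    rw [← e.image_eq_preimage_symm]
    exact he.measurableSet_image.mpr hs
  let E : unitInterval ≃ᵐ unitInterval := ⟨e, hφ.measurable, hsymm⟩
  exact ⟨e.symm, ⟨MeasurePreserving.symm E hφ, e.symm.bijective⟩,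
    funext e.apply_symm_apply, funext e.symm_apply_apply⟩

theorem deltaCut_eq_iInf {Y ι : Type*} [MeasurableSpace Y]
    {d : (Sq → Measure Y) → (Sq → Measure Y) → ℝ} {U W : Sq → Measure Y} {f : ι → ℝ}
    (hle : ∀ i, deltaCut d U W ≤ f i)
    (hex : ∀ φ : unitInterval → unitInterval, IsMP φ → Function.Bijective φ →
      ∃ i, f i = d U (relabel W φ)) :
    deltaCut d U W = ⨅ i, f i := by
  obtain ⟨i₀, -⟩ := hex id isMP_id Function.bijective_id
  have : Nonempty ι := ⟨i₀⟩
  have : Nonempty {φ : unitInterval → unitInterval // IsMP φ ∧ Function.Bijective φ} :=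
    ⟨⟨id, isMP_id, Function.bijective_id⟩⟩
  refine le_antisymm (le_ciInf hle) (le_ciInf fun φ => ?_)
  obtain ⟨i, hi⟩ := hex φ.1 φ.2.1 φ.2.2
  rw [← hi]
  exact ciInf_le ⟨deltaCut d U W, Set.forall_mem_range.mpr hle⟩ i

section GraphonDist

variable [PolishSpace Z] [BorelSpace Z] {d : (Sq → Measure Z) → (Sq → Measure Z) → ℝ}
  {U W : Sq → Measure Z}

theorem IsGraphonDist.tendsto_relabel_relabel (hdist : IsGraphonDist d) (hsmooth : Smooth d)
    (hU : IsProbGraphon U) (hW : IsProbGraphon W)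
    {τ σ : ℕ → unitInterval → unitInterval} {τ' σ' : unitInterval → unitInterval}
    (hτ : ∀ n, IsMP (τ n)) (hτ' : IsMP τ') (hσ : ∀ n, IsMP (σ n)) (hσ' : IsMP σ')
    (hτlim : ∀ᵐ x, Tendsto (fun n => τ n x) atTop (𝓝 (τ' x)))
    (hσlim : ∀ᵐ x, Tendsto (fun n => σ n x) atTop (𝓝 (σ' x))) :
    Tendsto (fun n => d (relabel U (τ n)) (relabel W (σ n))) atTop
      (𝓝 (d (relabel U τ') (relabel W σ'))) := by
  obtain ⟨hsymm, -, htri, -⟩ := hdist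
  have hUτ n := hU.relabel (hτ n)
  have hUτ' := hU.relabel hτ'
  have hWσ n := hW.relabel (hσ n)
  have hWσ' := hW.relabel hσ'
  have hsum := (hsmooth.tendsto_relabel hU hτ hτ' hτlim).add
    (hsmooth.tendsto_relabel hW hσ hσ' hσlim)
  rw [add_zero] at hsum
  refine tendsto_iff_dist_tendsto_zero.mpr
    (squeeze_zero (fun _ => dist_nonneg) (fun n => ?_) hsum)
  rw [Real.dist_eq, abs_sub_le_iff]
  have h₁ := htri _ _ _ (hUτ n) hUτ' (hWσ n)
  have h₂ := htri _ _ _ hUτ' hWσ' (hWσ n)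
  have h₃ := htri _ _ _ hUτ' (hUτ n) hWσ'
  have h₄ := htri _ _ _ (hUτ n) (hWσ n) hWσ'
  have h₅ := hsymm _ _ hUτ' (hUτ n)
  have h₆ := hsymm _ _ hWσ' (hWσ n)
  constructor <;> linarith

theorem IsGraphonDist.relabel_eq (hdist : IsGraphonDist d) (hinv : Invariant d)
    (hsmooth : Smooth d) (hU : IsProbGraphon U) (hW : IsProbGraphon W)
    {φ : unitInterval → unitInterval} (hφ : IsMP φ) :
    d (relabel U φ) (relabel W φ) = d U W := by
  obtain ⟨φn, hφn, hlim⟩ := hφ.exists_seq_bijective_tendsto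
  have h := hdist.tendsto_relabel_relabel hsmooth hU hW (fun n => (hφn n).1) hφ
    (fun n => (hφn n).1) hφ hlim hlim
  simp_rw [fun n => hinv U W hU hW (φn n) (hφn n).1 (hφn n).2] at h
  exact tendsto_nhds_unique h tendsto_const_nhds

theorem IsGraphonDist.deltaCut_le (hdist : IsGraphonDist d) (hinv : Invariant d)
    (hsmooth : Smooth d) (hU : IsProbGraphon U) (hW : IsProbGraphon W)
    {φ ψ : unitInterval → unitInterval} (hφ : IsMP φ) (hψ : IsMP ψ) :
    deltaCut d U W ≤ d (relabel U ψ) (relabel W φ) := by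
  obtain ⟨φn, hφn, hφlim⟩ := hφ.exists_seq_bijective_tendsto
  obtain ⟨ψn, hψn, hψlim⟩ := hψ.exists_seq_bijective_tendsto
  refine ge_of_tendsto' (hdist.tendsto_relabel_relabel hsmooth hU hW (fun n => (hψn n).1) hψ
    (fun n => (hφn n).1) hφ hψlim hφlim) fun n => ?_
  obtain ⟨χ, ⟨hχ, hχb⟩, hχr, -⟩ := (hψn n).1.exists_bijective_inverse (hψn n).2
  have hinv' := hinv _ _ (hU.relabel (hψn n).1) (hW.relabel (hφn n).1) χ hχ hχb
  have hUid : relabel (relabel U (ψn n)) χ = U := by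
    change relabel U (ψn n ∘ χ) = U
    rw [hχr]
    rfl
  rw [hUid] at hinv'
  rw [← hinv']
  refine ciInf_le (f := fun φ : {φ : unitInterval → unitInterval // IsMP φ ∧
    Function.Bijective φ} => d U (relabel W φ.val)) ⟨0, ?_⟩
    ⟨φn n ∘ χ, (hφn n).1.comp hχ, (hφn n).2.comp hχb⟩
  rintro _ ⟨φ', rfl⟩
  exact hdist.2.1 _ _ hU (hW.relabel φ'.2.1)

theorem IsGraphonDist.exists_deltaCut_eq (hdist : IsGraphonDist d) (hinv : Invariant d)
    (hsmooth : Smooth d) (hU : IsProbGraphon U) (hW : IsProbGraphon W) :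
    ∃ φ ψ : unitInterval → unitInterval, IsMP φ ∧ IsMP ψ ∧
      d (relabel U ψ) (relabel W φ) = deltaCut d U W := by
  have : Nonempty {φ : unitInterval → unitInterval // IsMP φ ∧ Function.Bijective φ} :=
    ⟨⟨id, isMP_id, Function.bijective_id⟩⟩
  have hmin (n : ℕ) : ∃ φ : {φ : unitInterval → unitInterval // IsMP φ ∧ Function.Bijective φ},
      d U (relabel W φ.val) < deltaCut d U W + 1 / ((n : ℝ) + 1) :=
    exists_lt_of_ciInf_lt (lt_add_of_pos_right _ Nat.one_div_pos_of_nat)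
  choose φ hφ using hmin
  have hφlim : Tendsto (fun n => d U (relabel W (φ n).val)) atTop (𝓝 (deltaCut d U W)) := by
    refine tendsto_of_tendsto_of_tendsto_of_le_of_le tendsto_const_nhds ?_
      (fun n => hdist.deltaCut_le hinv hsmooth hU hW (φ n).2.1 isMP_id) fun n => (hφ n).le
    simpa using (tendsto_one_div_add_atTop_nhds_zero_nat (𝕜 := ℝ)).const_add (deltaCut d U W)
  obtain ⟨ns, α, α', β', hns, hα, hα', hβ', hαlim, hβlim⟩ :=
    exists_subseq_parametrization_tendsto fun n => (φ n).2.1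
  have hlim := hdist.tendsto_relabel_relabel hsmooth hU hW hα hα'
    (fun j => (φ (ns j)).2.1.comp (hα j)) hβ' hαlim hβlim
  have heq (j : ℕ) : d (relabel U (α j)) (relabel W ((φ (ns j)).val ∘ α j)) =
      d U (relabel W (φ (ns j)).val) :=
    hdist.relabel_eq hinv hsmooth hU (hW.relabel (φ (ns j)).2.1) (hα j)
  simp_rw [heq] at hlim
  exact ⟨β', α', hβ', hα', tendsto_nhds_unique hlim (hφlim.comp hns.tendsto_atTop)⟩

end GraphonDist

/-- **Minima in the unlabeled cut distance.**
Let `d` be an invariant and smooth distance on the space `𝒲₁` of probability-graphons.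
Then for all probability-graphons `U, W`, the unlabeled cut distance
`δ_□(U,W) = inf_{φ ∈ S_{[0,1]}} d(U, W^φ)` coincides with the infima of `d(U, W^φ)`
over `φ ∈ S̄_{[0,1]}`, of `d(U^ψ, W)` over `ψ ∈ S_{[0,1]}` and over `ψ ∈ S̄_{[0,1]}`,
and of `d(U^ψ, W^φ)` over pairs `φ, ψ ∈ S_{[0,1]}`; moreover the infimum of
`d(U^ψ, W^φ)` over pairs of (not necessarily bijective) measure-preserving maps
`φ, ψ ∈ S̄_{[0,1]}` is attained and equals `δ_□(U,W)`. -/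
theorem min_in_unlabeled_cut_distance
    {Z : Type*} [MeasurableSpace Z] [TopologicalSpace Z] [PolishSpace Z] [BorelSpace Z]
    (d : (Sq → Measure Z) → (Sq → Measure Z) → ℝ)
    (hdist : IsGraphonDist d) (hinv : Invariant d) (hsmooth : Smooth d)
    (U W : Sq → Measure Z) (hU : IsProbGraphon U) (hW : IsProbGraphon W) :
    (deltaCut d U W =
      ⨅ φ : {φ : unitInterval → unitInterval // IsMP φ}, d U (relabel W φ.val)) ∧
    (deltaCut d U W =
      ⨅ ψ : {ψ : unitInterval → unitInterval // IsMP ψ ∧ Function.Bijective ψ},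
        d (relabel U ψ.val) W) ∧
    (deltaCut d U W =
      ⨅ ψ : {ψ : unitInterval → unitInterval // IsMP ψ}, d (relabel U ψ.val) W) ∧
    (deltaCut d U W =
      ⨅ q : {q : (unitInterval → unitInterval) × (unitInterval → unitInterval) //
          (IsMP q.1 ∧ Function.Bijective q.1) ∧ (IsMP q.2 ∧ Function.Bijective q.2)},
        d (relabel U q.val.2) (relabel W q.val.1)) ∧
    (∃ φ ψ : unitInterval → unitInterval, IsMP φ ∧ IsMP ψ ∧
      d (relabel U ψ) (relabel W φ) = deltaCut d U W ∧
      ∀ φ' ψ' : unitInterval → unitInterval, IsMP φ' → IsMP ψ' →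
        deltaCut d U W ≤ d (relabel U ψ') (relabel W φ')) := by
  have hle {φ ψ : unitInterval → unitInterval} (hφ : IsMP φ) (hψ : IsMP ψ) :=
    hdist.deltaCut_le hinv hsmooth hU hW hφ hψ
  have hswap (φ : unitInterval → unitInterval) (hφ : IsMP φ) (hb : Function.Bijective φ) :
      ∃ ψ, (IsMP ψ ∧ Function.Bijective ψ) ∧ d (relabel U ψ) W = d U (relabel W φ) := by
    obtain ⟨ψ, hψ, -, hψφ⟩ := hφ.exists_bijective_inverse hb
    refine ⟨ψ, hψ, ?_⟩
    rw [← hinv _ _ (hU.relabel hψ.1) hW φ hφ hb]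
    change d (relabel U (ψ ∘ φ)) _ = _
    rw [hψφ]
    rfl
  obtain ⟨φ, ψ, hφ, hψ, heq⟩ := hdist.exists_deltaCut_eq hinv hsmooth hU hW
  refine ⟨deltaCut_eq_iInf (fun φ => hle φ.2 isMP_id) fun φ hφ _ => ⟨⟨φ, hφ⟩, rfl⟩,
    deltaCut_eq_iInf (fun ψ => hle isMP_id ψ.2.1) fun φ hφ hb => ?_,
    deltaCut_eq_iInf (fun ψ => hle isMP_id ψ.2) fun φ hφ hb => ?_,
    deltaCut_eq_iInf (fun q => hle q.2.1.1 q.2.2.1) fun φ hφ hb =>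
      ⟨⟨(φ, id), ⟨hφ, hb⟩, isMP_id, Function.bijective_id⟩, rfl⟩,
    φ, ψ, hφ, hψ, heq, fun _ _ => hle⟩
  · obtain ⟨ψ, hψ, h⟩ := hswap φ hφ hb
    exact ⟨⟨ψ, hψ⟩, h⟩
  · obtain ⟨ψ, hψ, h⟩ := hswap φ hφ hb
    exact ⟨⟨ψ, hψ.1⟩, h⟩

end PG
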